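/- For all integers n ≥ 2 and d ≥ 1, the sum of d^{c(τ)} over all permutations τ ∈ S_n such that the elements 1 and 2 lie in the same cycle of τ (i.e., 2 belongs to the orbit of 1 under τ) equals d·∏_{i=2}^{n−1}(d+i) (with the empty product for n = 2 equal to 1). -/

import Mathlib

open Finset

/-- number of cycles of `τ`, counting fixed points as 1-cycles. -/
def cycCount {n : ℕ} (τ : Equiv.Perm (Fin n)) : ℕ :=
  τ.cycleType.card + (Finset.univ.filter fun x => τ x = x).card

open Equiv Equiv.Perm

/-- `SameCycle` is the smallest equivalence relation relating each `x` to `τ x`. -/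
theorem sameCycle_le_setoid {α : Type*} [Finite α] {τ : Perm α} (r : Setoid α)
    (h : ∀ x, r x (τ x)) {x y : α} (hxy : τ.SameCycle x y) : r x y := by
  obtain ⟨i, rfl⟩ := hxy.exists_nat_pow_eq
  clear hxy
  induction i with
  | zero => exact r.refl _
  | succ i ih =>
    rw [pow_succ', Perm.mul_apply]
    exact r.trans ih (h _)

/-- The number of cycles is the number of values of any function separating exactly the cycles. -/
theorem cycCount_eq_card_image {n : ℕ} {τ : Perm (Fin n)} {β : Type*} [DecidableEq β]
    (h : Fin n → β) (hh : ∀ x y, h x = h y ↔ τ.SameCycle x y) :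
    cycCount τ = #(univ.image h) := by
  classical
  let g : Fin n → Perm (Fin n) ⊕ Fin n := fun x => if τ x = x then .inr x else .inl (τ.cycleOf x)
  have hg : ∀ x y, g x = g y ↔ τ.SameCycle x y := by
    intro x y
    by_cases hx : τ x = x <;> by_cases hy : τ y = y <;> simp only [g, hx, hy, if_true, if_false]
    · exact ⟨fun e => by cases e; rfl, fun e => by rw [e.eq_of_left hx]⟩
    · simpa using fun e : τ.SameCycle x y => hy (e.apply_eq_self_iff.1 hx)
    · simpa using fun e : τ.SameCycle x y => hx (e.apply_eq_self_iff.2 hy)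
    · rw [Sum.inl.injEq, sameCycle_iff_cycleOf_eq_of_mem_support] <;> simpa
  have hcard : #(univ.image g) = #(univ.image h) := by
    have key : ∀ x y, g x = g y ↔ h x = h y := fun x y => (hg x y).trans (hh x y).symm
    refine card_bij (fun b hb => h (mem_image.1 hb).choose) (fun b hb => by simp) ?_ ?_
    · intro b hb c hc e
      rw [← key, (mem_image.1 hb).choose_spec.2, (mem_image.1 hc).choose_spec.2] at e
      exact e
    · intro c hc
      obtain ⟨x, -, rfl⟩ := mem_image.1 hc
      refine ⟨g x, by simp, ?_⟩
      rw [← key]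
      exact (mem_image.1 (mem_image_of_mem g (mem_univ x))).choose_spec.2
  have himage : univ.image g =
      τ.cycleFactorsFinset.disjSum (univ.filter fun x => τ x = x) := by
    ext (c | x)
    · simp only [mem_image, mem_univ, true_and, inl_mem_disjSum]
      constructor
      · rintro ⟨x, hx⟩
        by_cases hf : τ x = x
        · simp [g, hf] at hx
        · simp only [g, hf, if_false, Sum.inl.injEq] at hx
          rw [← hx, cycleOf_mem_cycleFactorsFinset_iff]
          simpa
      · intro hc
        obtain ⟨x, hx⟩ := IsCycle.nonempty_support (mem_cycleFactorsFinset_iff.mp hc).1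
        have hx' : τ x ≠ x := mem_support.1 (mem_cycleFactorsFinset_support_le hc hx)
        refine ⟨x, ?_⟩
        simp only [g, hx', if_false]
        rw [cycle_is_cycleOf hx hc]
    · simp only [mem_image, mem_univ, true_and, inr_mem_disjSum, mem_filter]
      constructor
      · rintro ⟨y, hy⟩
        by_cases hf : τ y = y
        · simp only [g, hf, if_true, Sum.inr.injEq] at hy
          rwa [← hy]
        · simp [g, hf] at hy
      · exact fun hx => ⟨x, by simp [g, hx]⟩
  rw [← hcard, himage, card_disjSum, cycCount, cycleType_def]
  simp

theorem sameCycle_swap_mul {α : Type*} [Finite α] [DecidableEq α] {τ : Perm α} {a b : α}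
    (hab : ¬ τ.SameCycle a b) : (swap a b * τ).SameCycle a b := by
  have hpow : ∀ i : ℕ, (swap a b * τ).SameCycle a ((τ ^ i) a) := by
    intro i
    induction i with
    | zero => exact SameCycle.rfl
    | succ i ih =>
      by_cases ha : (τ ^ (i + 1)) a = a
      · rw [ha]
      · have hb : (τ ^ (i + 1)) a ≠ b := fun hb => hab ⟨(i + 1 : ℕ), by rw [zpow_natCast, hb]⟩
        rw [← sameCycle_apply_right] at ih
        rwa [Perm.mul_apply, ← Perm.mul_apply τ, ← pow_succ', swap_apply_of_ne_of_ne ha hb] at ih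
  obtain ⟨i, hi⟩ := (show τ.SameCycle a (τ⁻¹ a) from ⟨-1, by simp⟩).exists_nat_pow_eq
  have := hpow i
  rw [hi, ← sameCycle_apply_right] at this
  simpa using this

theorem cycCount_swap_mul_add_one {n : ℕ} {τ : Perm (Fin n)} {a b : Fin n}
    (hab : ¬ τ.SameCycle a b) : cycCount (swap a b * τ) + 1 = cycCount τ := by
  classical
  have hs := sameCycle_swap_mul hab
  set σ := swap a b * τ with hσ
  let mk : Fin n → Quotient (SameCycle.setoid τ) := Quotient.mk _
  have hmk : ∀ x y, mk x = mk y ↔ τ.SameCycle x y := fun x y => Quotient.eq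
  let h : Fin n → Quotient (SameCycle.setoid τ) := fun x => if mk x = mk b then mk a else mk x
  have hswap : ∀ x, h (swap a b x) = h x := by
    intro x
    rcases eq_or_ne x a with rfl | hxa
    · simp [h]
    rcases eq_or_ne x b with rfl | hxb
    · simp [h]
    rw [swap_apply_of_ne_of_ne hxa hxb]
  have hτ : ∀ x, mk (τ x) = mk x := fun x => by simp [hmk, SameCycle.refl]
  have hle : ∀ {x y}, τ.SameCycle x y → σ.SameCycle x y := by
    refine sameCycle_le_setoid (SameCycle.setoid σ) fun x => ?_
    have hx : σ.SameCycle x (σ x) := by simp [SameCycle.refl]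
    change σ.SameCycle x (τ x)
    rw [hσ, Perm.mul_apply, ← hσ] at hx
    by_cases ha : τ x = a
    · rw [ha, swap_apply_left] at hx
      exact ha ▸ hx.trans hs.symm
    by_cases hb : τ x = b
    · rw [hb, swap_apply_right] at hx
      exact hb ▸ hx.trans hs
    rwa [swap_apply_of_ne_of_ne ha hb] at hx
  have hσh : ∀ x y, h x = h y ↔ σ.SameCycle x y := by
    refine fun x y => ⟨fun e => ?_, sameCycle_le_setoid (Setoid.ker h) fun x => ?_⟩
    · have rep : ∀ x, ∃ z, σ.SameCycle x z ∧ h x = mk z := by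
        intro x
        by_cases hx : mk x = mk b
        · exact ⟨a, (hle ((hmk _ _).1 hx)).trans hs.symm, by simp [h, hx]⟩
        · exact ⟨x, .rfl, by simp [h, hx]⟩
      obtain ⟨z, hz, ez⟩ := rep x
      obtain ⟨w, hw, ew⟩ := rep y
      exact (hz.trans (hle ((hmk _ _).1 (ez.symm.trans (e.trans ew))))).trans hw.symm
    · change h x = h (swap a b (τ x))
      rw [hswap]
      simp only [h, hτ]
  have hne : mk a ≠ mk b := fun e => hab ((hmk _ _).1 e)
  rw [cycCount_eq_card_image h hσh, cycCount_eq_card_image mk hmk]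
  have himage : univ.image h = (univ.image mk).erase (mk b) := by
    ext q
    simp only [mem_image, mem_univ, true_and, mem_erase]
    constructor
    · rintro ⟨x, rfl⟩
      by_cases hx : mk x = mk b
      · simp [h, hx, hne]
      · simp [h, hx]
    · rintro ⟨hq, x, rfl⟩
      exact ⟨x, by simp [h, hq]⟩
  rw [himage, card_erase_add_one (by simp)]

theorem sign_eq_neg_one_pow_cycCount {n : ℕ} (τ : Perm (Fin n)) :
    sign τ = (-1) ^ (n + cycCount τ) := by
  have hfix : n = #τ.support + #(univ.filter fun x => τ x = x) := by
    have := card_filter_add_card_filter_not (s := (univ : Finset (Fin n))) (fun x => τ x = x)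
    rw [card_univ, Fintype.card_fin, add_comm] at this
    exact this.symm
  have hexp : n + cycCount τ = #τ.support + τ.cycleType.card +
      2 * #(univ.filter fun x => τ x = x) := by
    rw [cycCount]
    omega
  rw [sign_of_cycleType, sum_cycleType, hexp, pow_add _ (_ + _), pow_mul]
  simp

theorem not_sameCycle_swap_mul {n : ℕ} {τ : Perm (Fin n)} {a b : Fin n} (hne : a ≠ b)
    (hab : τ.SameCycle a b) : ¬ (swap a b * τ).SameCycle a b := by
  classical
  intro hs
  have hle : ∀ {ρ : Perm (Fin n)}, ρ.SameCycle a b → ∀ {x y},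
      (swap a b * ρ).SameCycle x y → ρ.SameCycle x y := by
    intro ρ hρ
    refine sameCycle_le_setoid (SameCycle.setoid ρ) fun x => ?_
    change ρ.SameCycle x (swap a b (ρ x))
    have hx : ρ.SameCycle x (ρ x) := by simp [SameCycle.refl]
    by_cases ha : ρ x = a
    · rw [ha] at hx ⊢
      rw [swap_apply_left]
      exact hx.trans hρ
    by_cases hb : ρ x = b
    · rw [hb] at hx ⊢
      rw [swap_apply_right]
      exact hx.trans hρ.symm
    rwa [swap_apply_of_ne_of_ne ha hb]
  have hiff : ∀ x y, τ.SameCycle x y ↔ (swap a b * τ).SameCycle x y := fun x y =>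
    ⟨fun e => hle hs (by rwa [← mul_assoc, swap_mul_self, one_mul]), hle hab⟩
  let mk : Fin n → Quotient (SameCycle.setoid τ) := Quotient.mk _
  have hmk : ∀ x y, mk x = mk y ↔ τ.SameCycle x y := fun x y => Quotient.eq
  have hcount : cycCount (swap a b * τ) = cycCount τ := by
    rw [cycCount_eq_card_image mk hmk,
      cycCount_eq_card_image mk fun x y => (hmk x y).trans (hiff x y)]
  have hsign := sign_eq_neg_one_pow_cycCount (swap a b * τ)
  rw [hcount, ← sign_eq_neg_one_pow_cycCount, Perm.sign_mul, sign_swap hne] at hsign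
  simp at hsign

theorem sameCycle_swap_mul_iff {n : ℕ} {τ : Perm (Fin n)} {a b : Fin n} (hne : a ≠ b) :
    (swap a b * τ).SameCycle a b ↔ ¬ τ.SameCycle a b :=
  ⟨fun h h' => not_sameCycle_swap_mul hne h' h, sameCycle_swap_mul⟩

theorem decomposeFin_symm_eq_swap_mul {n : ℕ} (p : Fin (n + 1)) (e : Perm (Fin n)) :
    decomposeFin.symm (p, e) = swap 0 p * decomposeFin.symm (0, e) := by
  ext x
  refine Fin.cases ?_ (fun x => ?_) x <;> simp

theorem cycCount_decomposeFin_symm_zero {n : ℕ} (e : Perm (Fin n)) :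
    cycCount (decomposeFin.symm (0, e)) = cycCount e + 1 := by
  classical
  let mk : Fin n → Quotient (SameCycle.setoid e) := Quotient.mk _
  have hmk : ∀ x y, mk x = mk y ↔ e.SameCycle x y := fun x y => Quotient.eq
  let h : Fin (n + 1) → Option (Quotient (SameCycle.setoid e)) :=
    Fin.cases none fun x => some (mk x)
  have hh : ∀ x y, h x = h y ↔ (decomposeFin.symm (0, e)).SameCycle x y := by
    refine fun x y => ⟨?_, sameCycle_le_setoid (Setoid.ker h) fun x => ?_⟩
    · refine Fin.cases ?_ (fun x => ?_) x <;> refine Fin.cases ?_ (fun y => ?_) y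
      · exact fun _ => .rfl
      · simp [h]
      · simp [h]
      · intro hxy
        simp only [h, Fin.cases_succ, Option.some.injEq, hmk] at hxy
        refine sameCycle_le_setoid
          ((SameCycle.setoid (decomposeFin.symm (0, e))).comap Fin.succ) (fun z => ?_) hxy
        exact ⟨1, by simp⟩
    · change h x = h _
      refine Fin.cases ?_ (fun x => ?_) x
      · simp
      · simp [h, hmk, SameCycle.refl]
  rw [cycCount_eq_card_image h hh, cycCount_eq_card_image mk hmk, ← card_insertNone]
  congr 1
  ext q
  cases q <;> simp [h, Fin.exists_fin_succ]

/-- The generating function of the number of cycles is the rising factorial. -/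
theorem sum_pow_cycCount (n d : ℕ) :
    ∑ τ : Perm (Fin n), d ^ cycCount τ = ∏ i ∈ range n, (d + i) := by
  induction n with
  | zero => simp [cycCount]
  | succ n ih =>
    have hsucc : ∀ (p : Fin n) (e : Perm (Fin n)),
        cycCount (decomposeFin.symm (p.succ, e)) = cycCount e := by
      intro p e
      have := cycCount_swap_mul_add_one (τ := decomposeFin.symm (0, e)) (a := 0) (b := p.succ)
        fun h => (Fin.succ_ne_zero p) (h.eq_of_left (by simp [Function.IsFixedPt])).symm
      rw [← decomposeFin_symm_eq_swap_mul, cycCount_decomposeFin_symm_zero] at this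
      omega
    rw [← decomposeFin.symm.sum_comp, Fintype.sum_prod_type, Fin.sum_univ_succ]
    simp only [hsucc, cycCount_decomposeFin_symm_zero, pow_succ, ← sum_mul, ih, sum_const,
      card_univ, Fintype.card_fin, prod_range_succ, smul_eq_mul]
    ring

theorem sum_sameCycle_pow_cycCount (n d : ℕ) (hn : 2 ≤ n) (hd : 1 ≤ d) :
    ∑ τ ∈ Finset.univ.filter
        (fun τ : Equiv.Perm (Fin n) => τ.SameCycle ⟨0, by omega⟩ ⟨1, by omega⟩),
      d ^ cycCount τ = d * ∏ i ∈ Finset.Ico 2 n, (d + i) := by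
  set a : Fin n := ⟨0, by omega⟩
  set b : Fin n := ⟨1, by omega⟩
  have hne : a ≠ b := by simp [a, b]
  have hsplit : ∑ τ : Perm (Fin n) with ¬ τ.SameCycle a b, d ^ cycCount τ =
      d * ∑ τ : Perm (Fin n) with τ.SameCycle a b, d ^ cycCount τ := by
    rw [mul_sum]
    refine sum_equiv (Equiv.mulLeft (swap a b)) (fun τ => ?_) fun τ hτ => ?_
    · simp [sameCycle_swap_mul_iff hne]
    · rw [Equiv.coe_mulLeft, ← cycCount_swap_mul_add_one (mem_filter.1 hτ).2, pow_succ']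
  have htotal := sum_filter_add_sum_filter_not univ (fun τ : Perm (Fin n) => τ.SameCycle a b)
    fun τ => d ^ cycCount τ
  rw [hsplit, sum_pow_cycCount, ← prod_range_mul_prod_Ico _ hn] at htotal
  simp only [prod_range_succ, prod_range_zero] at htotal
  refine Nat.eq_of_mul_eq_mul_left (Nat.succ_pos d) ?_
  rw [Nat.succ_eq_add_one]
  linarith
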